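/- Let D be an integral domain and let S be a multiplicatively closed subset of D consisting of nonzero elements. Then the composite R = D+XD_S[X] is an S-domain; that is, for every prime ideal P of R of height 1, the extended ideal P·R[Y] generated by the image of P in the polynomial ring R[Y] has height 1. -/

import Mathlib

open Polynomial

/-- The height of an ideal: the infimum, over prime ideals `P` containing `I`, of the
height of `P` in the poset of prime ideals (the supremum of lengths of chains of primes
descending from `P`). -/
noncomputable def idealHeight {R : Type*} [CommRing R] (I : Ideal R) : ℕ∞ :=
  ⨅ P ∈ {P : PrimeSpectrum R | I ≤ P.asIdeal}, Order.height P

/-- An S-domain: for every prime ideal `P` of height 1, the extended ideal `P·R[X]`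
(generated by the image of `P` under the constant-coefficient embedding `R → R[X]`)
has height 1 in `R[X]`. -/
def IsSDomain (R : Type*) [CommRing R] : Prop :=
  ∀ P : Ideal R, P.IsPrime → idealHeight P = 1 →
    idealHeight (P.map (Polynomial.C : R →+* Polynomial R)) = 1

/-- The composite `A + X B[X]`: the subring of the polynomial ring `B[X]` consisting of
polynomials whose constant coefficient lies in the subring `A`. -/
def composite {B : Type*} [CommRing B] (A : Subring B) : Subring (Polynomial B) where
  carrier := {f | f.coeff 0 ∈ A}
  mul_mem' := fun hf hg => by simpa [Polynomial.mul_coeff_zero] using A.mul_mem hf hg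
  one_mem' := by simpa using A.one_mem
  add_mem' := fun hf hg => by simpa using A.add_mem hf hg
  zero_mem' := by simpa using A.zero_mem
  neg_mem' := fun hf => by simpa using A.neg_mem hf


/-! ### Heights -/

theorem aux_idealHeight_eq {R : Type*} [CommRing R] (P : Ideal R) [hP : P.IsPrime] :
    idealHeight P = P.height := by
  have h := PrimeSpectrum.height_eq_orderHeight (⟨P, hP⟩ : PrimeSpectrum R)
  simp only at h
  rw [h]
  refine le_antisymm ?_ ?_
  · exact iInf₂_le (⟨P, hP⟩ : PrimeSpectrum R) (le_refl P)
  · refine le_iInf₂ fun Q hQ => ?_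
    exact Order.height_mono (show (⟨P, hP⟩ : PrimeSpectrum R) ≤ Q from hQ)

theorem aux_height_one_iff {R : Type*} [CommRing R] [IsDomain R] (P : Ideal R) [hP : P.IsPrime] :
    P.height = 1 ↔ P ≠ ⊥ ∧ ∀ Q : Ideal R, Q.IsPrime → Q < P → Q = ⊥ := by
  have h0 : P.height = 0 ↔ P = ⊥ := Ideal.height_eq_zero_iff_eq_bot
  have h1 : P.height ≤ (1 : ℕ) ↔ _ := Ideal.height_le_iff (p := P) (n := 1)
  have h2 : P.height ≤ 1 ↔ ∀ Q : Ideal R, Q.IsPrime → Q < P → Q = ⊥ := by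
    rw [← Nat.cast_one, h1]
    refine forall_congr' fun Q => ?_
    refine forall_congr' fun hQ => ?_
    refine forall_congr' fun hlt => ?_
    rw [Nat.cast_one, Order.lt_one_iff, Ideal.height_eq_zero_iff_eq_bot]
  rw [← h2, Ne, ← h0]
  constructor
  · intro h; rw [h]; simp
  · rintro ⟨h3, h4⟩
    exact le_antisymm h4 (Order.one_le_iff_ne_zero.mpr h3)

/-- The property `IsSDomain`, phrased with Mathlib's height. -/
def AuxSD (R : Type*) [CommRing R] : Prop :=
  ∀ P : Ideal R, P.IsPrime → P.height = 1 → (P.map (C : R →+* R[X])).height = 1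

theorem aux_isSDomain {R : Type*} [CommRing R] (h : AuxSD R) : IsSDomain R := by
  intro P hP h1
  rw [aux_idealHeight_eq] at h1 ⊢
  exact h P hP h1

/-! ### Transfer along localizations -/

theorem aux_transfer {R T : Type*} [CommRing R] [CommRing T] [Algebra R T] (M : Submonoid R)
    [IsLocalization M T] (hT : AuxSD T) (P : Ideal R) [hP : P.IsPrime]
    (hM : Disjoint (M : Set R) (P : Set R)) (h1 : P.height = 1) :
    (P.map (C : R →+* R[X])).height = 1 := by
  let := Polynomial.algebra R T
  have := Polynomial.isLocalization M T
  have hpr := IsLocalization.isPrime_of_isPrime_disjoint M T P hP hM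
  have h2 := IsLocalization.height_map_of_disjoint (S := T) M P hM
  have h3 := hT _ hpr (h2.trans h1)
  have hM' : Disjoint ((M.map (C : R →+* R[X]) : Submonoid R[X]) : Set R[X])
      ((P.map (C : R →+* R[X]) : Ideal R[X]) : Set R[X]) := by
    rw [Set.disjoint_left] at hM ⊢
    rintro _ ⟨m, hm, rfl⟩ hmem
    refine hM hm ?_
    have := Ideal.mem_map_C_iff.mp hmem 0
    simpa using this
  have h4 := IsLocalization.height_map_of_disjoint (S := T[X]) (M.map (C : R →+* R[X]))
    (P.map (C : R →+* R[X])) hM'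
  rw [← h4, ← h3, Ideal.map_map, Ideal.map_map]
  congr 2
  ext r
  simp [Polynomial.algebraMap_def]

/-! ### The valuation argument -/

theorem aux_valuation.{u} {A : Type u} [CommRing A] (Q M : Ideal A) [hQ : Q.IsPrime] [hM : M.IsPrime]
    (hQM : Q ≤ M) :
    ∃ (L : Type u) (_ : Field L) (W : ValuationSubring L) (f : A →+* W),
      (∀ a, f a = 0 ↔ a ∈ Q) ∧ (∀ a, IsLocalRing.residue W (f a) = 0 ↔ a ∈ M) := by
  let A' := Localization.AtPrime M
  let Q' : Ideal A' := Q.map (algebraMap A A')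
  have hd : Disjoint (M.primeCompl : Set A) (Q : Set A) := by
    rw [Set.disjoint_left]
    exact fun a ha hb => ha (hQM hb)
  have hQ' : Q'.IsPrime := IsLocalization.isPrime_of_isPrime_disjoint M.primeCompl A' Q hQ hd
  have hu : Q'.under A = Q := IsLocalization.under_map_of_isPrime_disjoint M.primeCompl A' hQ hd
  let L := FractionRing (A' ⧸ Q')
  let g : A' →+* L := (algebraMap (A' ⧸ Q') L).comp (Ideal.Quotient.mk Q')
  obtain ⟨W, h, hloc⟩ := IsLocalRing.exists_factor_valuationRing g
  let g' : A' →+* W := g.codRestrict W.toSubring h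
  have : IsLocalHom g' := hloc
  refine ⟨L, inferInstance, W, g'.comp (algebraMap A A'), ?_, ?_⟩
  · intro a
    have e1 : g' (algebraMap A A' a) = 0 ↔ g (algebraMap A A' a) = 0 := by
      rw [← Subtype.val_inj]; rfl
    rw [RingHom.comp_apply, e1]
    simp only [g, RingHom.comp_apply]
    rw [map_eq_zero_iff _ (IsFractionRing.injective (A' ⧸ Q') L), Ideal.Quotient.eq_zero_iff_mem]
    conv_rhs => rw [← hu]
    rfl
  · intro a
    rw [IsLocalRing.residue_eq_zero_iff, RingHom.comp_apply, IsLocalRing.mem_maximalIdeal,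
      mem_nonunits_iff, isUnit_map_iff, IsLocalization.AtPrime.isUnit_to_map_iff A' M]
    simp [Ideal.primeCompl]

theorem aux_core {D : Type*} [CommRing D] [IsDomain D] {σ : Type*} (p : Ideal D) [hp : p.IsPrime]
    (hp0 : p ≠ ⊥)
    (h1 : ∀ q : Ideal D[X], q.IsPrime → q < p.map (C : D →+* D[X]) → q = ⊥)
    (hpσ : (p.map (MvPolynomial.C : D →+* MvPolynomial σ D)).IsPrime)
    (Q : Ideal (MvPolynomial σ D)) [hQ : Q.IsPrime]
    (hQp : Q ≤ p.map (MvPolynomial.C : D →+* MvPolynomial σ D))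
    (hQD : ∀ a : D, MvPolynomial.C a ∈ Q → a = 0) : Q = ⊥ := by
  obtain ⟨L, _, W, f, hf0, hfM⟩ := aux_valuation Q _ hQp
  let κ := IsLocalRing.ResidueField W
  let res : W →+* κ := IsLocalRing.residue W
  let φ : D →+* W := f.comp MvPolynomial.C
  have hφ0 : ∀ a, φ a = 0 → a = 0 := fun a ha => hQD a ((hf0 _).mp ha)
  have hφp : ∀ a, res (φ a) = 0 ↔ a ∈ p := by
    intro a
    refine (hfM _).trans ?_
    rw [MvPolynomial.mem_map_C_iff]
    constructor
    · intro h
      simpa using h 0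
    · intro h m
      classical
      rw [MvPolynomial.coeff_C]
      split_ifs
      · exact h
      · exact p.zero_mem
  let ψ : D ⧸ p →+* κ := Ideal.Quotient.lift p (res.comp φ) (fun a ha => (hφp a).mpr ha)
  let : Algebra (D ⧸ p) κ := ψ.toAlgebra
  have hψ : (algebraMap (D ⧸ p) κ).comp (Ideal.Quotient.mk p) = res.comp φ := by
    ext a; rfl
  -- quotients of elements of `D` have algebraic residues
  have halg : ∀ (a b : D) (u : W), b ≠ 0 → φ b * u = φ a → IsAlgebraic (D ⧸ p) (res u) := by
    intro a b u hb hu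
    let g : D[X] →+* W := Polynomial.eval₂RingHom φ u
    have hgC : ∀ d, g (C d) = φ d := fun d => by simp [g]
    have : (RingHom.ker g).IsPrime := RingHom.ker_isPrime g
    have hne : ¬ RingHom.ker g ≤ p.map (C : D →+* D[X]) := by
      intro hle
      rcases hle.lt_or_eq with hlt | heq
      · have := h1 _ inferInstance hlt
        have hmem : (C b * X - C a : D[X]) ∈ RingHom.ker g := by
          rw [RingHom.mem_ker]; simp [g, hu]
        rw [this, Ideal.mem_bot] at hmem
        have := congrArg (fun q => q.coeff 1) hmem
        simp [coeff_C] at this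
        exact hb this
      · obtain ⟨c, hc, hc0⟩ := Submodule.exists_mem_ne_zero_of_ne_bot hp0
        have : C c ∈ RingHom.ker g := heq ▸ Ideal.mem_map_of_mem _ hc
        rw [RingHom.mem_ker, hgC] at this
        exact hc0 (hφ0 _ this)
    obtain ⟨h, hh, hhp⟩ := SetLike.not_le_iff_exists.mp hne
    refine ⟨h.map (Ideal.Quotient.mk p), ?_, ?_⟩
    · intro h0
      apply hhp
      rw [Ideal.mem_map_C_iff]
      intro n
      rw [← Ideal.Quotient.eq_zero_iff_mem, ← coeff_map, h0, coeff_zero]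
    · rw [aeval_def, eval₂_map, hψ, ← Polynomial.hom_eval₂]
      have : eval₂ φ u h = 0 := hh
      rw [this, map_zero]
  -- residues of the variables are algebraically independent
  let x : σ → W := fun i => f (MvPolynomial.X i)
  have hfeval : ∀ F, f F = MvPolynomial.eval₂ φ x F := by
    intro F
    have : f = MvPolynomial.eval₂Hom φ x := by
      ext <;> simp [φ, x]
    rw [this]; simp
  have hind : AlgebraicIndependent (D ⧸ p) (fun i => res (x i)) := by
    rw [algebraicIndependent_iff]
    intro G hG
    obtain ⟨F, rfl⟩ := MvPolynomial.map_surjective (σ := σ) (Ideal.Quotient.mk p)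
      Ideal.Quotient.mk_surjective G
    rw [MvPolynomial.aeval_def, MvPolynomial.eval₂_map, hψ] at hG
    have h2 : res (f F) = 0 := by
      rw [hfeval, ← hG]
      exact MvPolynomial.eval₂_comp_left res φ x F
    have h3 := (hfM F).mp h2
    rw [MvPolynomial.mem_map_C_iff] at h3
    ext m
    rw [MvPolynomial.coeff_map, MvPolynomial.coeff_zero, Ideal.Quotient.eq_zero_iff_mem]
    exact h3 m
  have hind' := hind.subalgebraAlgebraicClosure
  rw [eq_bot_iff]
  intro F hF
  rw [Ideal.mem_bot]
  by_contra hF0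
  have hsupp : F.support.Nonempty := by
    rwa [Finset.nonempty_iff_ne_empty, Ne, MvPolynomial.support_eq_empty]
  obtain ⟨d, hd, hmax⟩ := Finset.exists_max_image F.support
    (fun e => W.valuation (φ (F.coeff e) : L)) hsupp
  have hc0 : F.coeff d ≠ 0 := MvPolynomial.mem_support_iff.mp hd
  have hφc : φ (F.coeff d) ≠ 0 := fun h => hc0 (hφ0 _ h)
  have hu : ∀ e, ∃ u : W, φ (F.coeff d) * u = φ (F.coeff e) := by
    intro e
    by_cases he : e ∈ F.support
    · have hφc' : (φ (F.coeff d) : L) ≠ 0 := fun h => hφc (Subtype.ext h)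
      have := hmax e he
      refine ⟨⟨(φ (F.coeff e) : L) / (φ (F.coeff d) : L), ?_⟩, ?_⟩
      · rw [← ValuationSubring.valuation_le_one_iff, map_div₀]
        exact div_le_one_of_le₀ this zero_le
      · apply Subtype.ext
        exact mul_div_cancel₀ _ hφc'
    · refine ⟨0, ?_⟩
      rw [MvPolynomial.notMem_support_iff.mp he]; simp
  choose u hu using hu
  let w : (σ →₀ ℕ) → Subalgebra.algebraicClosure (D ⧸ p) κ := fun e =>
    ⟨res (u e), halg _ _ _ hc0 (hu e)⟩
  let G : MvPolynomial σ (Subalgebra.algebraicClosure (D ⧸ p) κ) :=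
    ∑ e ∈ F.support, MvPolynomial.monomial e (w e)
  have hG0 : MvPolynomial.aeval (fun i => res (x i)) G = 0 := by
    have e1 : MvPolynomial.aeval (fun i => res (x i)) G
        = res (∑ e ∈ F.support, u e * ∏ i ∈ e.support, x i ^ e i) := by
      simp only [G, map_sum, MvPolynomial.aeval_monomial, map_mul, map_prod, map_pow]
      rfl
    have e2 : φ (F.coeff d) * (∑ e ∈ F.support, u e * ∏ i ∈ e.support, x i ^ e i) = 0 := by
      rw [← (hf0 F).mpr hF, hfeval, MvPolynomial.eval₂_eq, Finset.mul_sum]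
      refine Finset.sum_congr rfl fun e _ => ?_
      rw [← mul_assoc, hu]
    rw [e1, (mul_eq_zero.mp e2).resolve_left hφc, map_zero]
  have hG := (algebraicIndependent_iff.mp hind') G hG0
  have hcoef : G.coeff d = w d := by
    classical
    simp only [G, MvPolynomial.coeff_sum, MvPolynomial.coeff_monomial]
    rw [Finset.sum_ite_eq' F.support d, if_pos hd]
  rw [hG, MvPolynomial.coeff_zero] at hcoef
  have hud : u d = 1 := mul_left_cancel₀ hφc (by rw [hu, mul_one])
  have : res (u d) = 0 := (congrArg Subtype.val hcoef).symm
  rw [hud, map_one] at this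
  exact one_ne_zero this

/-! ### Polynomial rings are S-domains -/

theorem aux_pid {T : Type*} [CommRing T] [IsDomain T] [IsPrincipalIdealRing T] : AuxSD T := by
  intro P hP h1
  obtain ⟨g, rfl⟩ := (IsPrincipalIdealRing.principal P).principal
  rw [← Ideal.span] at *
  have h0 := Ideal.ne_bot_of_height_eq_one h1
  rw [Ideal.map_span, Set.image_singleton]
  apply Ideal.height_span_singleton_eq_one_of_mem_nonZeroDivisors
  · rw [mem_nonZeroDivisors_iff_ne_zero, Ne, C_eq_zero]
    rintro rfl
    exact h0 (by simp)
  · rw [Polynomial.isUnit_C]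
    intro hu
    exact hP.ne_top (Ideal.span_singleton_eq_top.mpr hu)

theorem aux_poly {B : Type*} [CommRing B] [IsDomain B] : AuxSD B[X] := by
  intro P hP h1
  let p : Ideal B := P.comap C
  have hp : p.IsPrime := Ideal.IsPrime.comap C
  by_cases hp0 : p = ⊥
  · let K := FractionRing B
    let := Polynomial.algebra B K
    have := Polynomial.isLocalization (nonZeroDivisors B) K
    refine aux_transfer (T := K[X]) ((nonZeroDivisors B).map (C : B →+* B[X])) aux_pid P ?_ h1
    rw [Set.disjoint_left]
    rintro _ ⟨m, hm, rfl⟩ hmem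
    have h2 : m ∈ p := hmem
    rw [hp0, Ideal.mem_bot] at h2
    exact nonZeroDivisors.ne_zero hm h2
  · rw [aux_height_one_iff] at h1
    have hle : p.map C ≤ P := Ideal.map_comap_le
    have hpP : p.map C = P := by
      refine (hle.lt_or_eq).resolve_left fun hlt => hp0 ?_
      have := h1.2 _ inferInstance hlt
      exact (Ideal.map_eq_bot_iff_of_injective C_injective).mp this
    rw [aux_height_one_iff]
    refine ⟨fun h => h1.1 ((Ideal.map_eq_bot_iff_of_injective C_injective).mp h), ?_⟩
    intro Q hQ hlt
    let e : B[X][X] ≃+* MvPolynomial (Fin 2) B :=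
      (Polynomial.Bivariate.equivMvPolynomial B).toRingEquiv
    have heC : ((e : B[X][X] →+* MvPolynomial (Fin 2) B).comp C).comp C = MvPolynomial.C := by
      ext b : 1
      exact (Polynomial.Bivariate.equivMvPolynomial B).commutes b
    have hmap : (P.map C).map (e : B[X][X] →+* MvPolynomial (Fin 2) B)
        = p.map MvPolynomial.C := by
      rw [← hpP, Ideal.map_map, Ideal.map_map, heC]
    have hpσ : (p.map (MvPolynomial.C : B →+* MvPolynomial (Fin 2) B)).IsPrime := by
      rw [← hmap]
      exact Ideal.map_isPrime_of_equiv e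
    have hQ' : (Q.map (e : B[X][X] →+* MvPolynomial (Fin 2) B)).IsPrime :=
      Ideal.map_isPrime_of_equiv e
    have hQD : ∀ a : B, C (C a) ∈ Q → a = 0 := by
      intro a ha
      by_contra ha0
      let q : Ideal B[X] := Q.comap C
      have hq : q.IsPrime := Ideal.IsPrime.comap C
      have hqP : q ≤ P := by
        intro z hz
        have := Ideal.mem_map_C_iff.mp (hlt.le hz) 0
        simpa using this
      rcases hqP.lt_or_eq with h | h
      · have h3 := h1.2 q hq h
        have h4 : C a ∈ q := ha
        rw [h3, Ideal.mem_bot, C_eq_zero] at h4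
        exact ha0 h4
      · apply hlt.not_ge
        rw [← h]
        exact Ideal.map_comap_le
    have key := aux_core (σ := Fin 2) p hp0 (by rw [hpP]; exact h1.2) hpσ
      (Q.map (e : B[X][X] →+* MvPolynomial (Fin 2) B))
      (by rw [← hmap]; exact Ideal.map_mono hlt.le)
      (by
        intro a ha
        apply hQD
        rw [← heC] at ha
        obtain ⟨z, hz, hze⟩ := (Ideal.mem_map_iff_of_surjective
          (e : B[X][X] →+* MvPolynomial (Fin 2) B) e.surjective).mp ha
        have : z = C (C a) := e.injective hze
        exact this ▸ hz)
    exact (Ideal.map_eq_bot_iff_of_injective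
      (f := (e : B[X][X] →+* MvPolynomial (Fin 2) B)) e.injective).mp key

/-! ### The composite -/

/-- for an integral domain `D` and a multiplicatively closed set `S` of
nonzero elements, the composite `D + X D_S[X]` is an S-domain. -/
theorem stmt10 {D : Type*} [CommRing D] [IsDomain D] (S : Submonoid D)
    (hS : ∀ s ∈ S, s ≠ (0 : D)) :
    IsSDomain (composite ((algebraMap D (Localization S)).range)) := by
  apply aux_isSDomain
  intro P hP h1
  have hS' : S ≤ nonZeroDivisors D := fun s hs => mem_nonZeroDivisors_of_ne_zero (hS s hs)
  have hB : IsDomain (Localization S) := IsLocalization.isDomain_localization hS'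
  have hinj : Function.Injective (algebraMap D (Localization S)) :=
    IsLocalization.injective _ hS'
  let B := Localization S
  let R := composite ((algebraMap D (Localization S)).range)
  let i : D →+* R := ((C : B →+* B[X]).comp (algebraMap D B)).codRestrict R (fun d => by
    change coeff (C (algebraMap D B d)) 0 ∈ (algebraMap D (Localization S)).range
    rw [coeff_C_zero]
    exact ⟨d, rfl⟩)
  have hi : ∀ d, ((i d : R) : B[X]) = C (algebraMap D B d) := fun d => rfl
  have hloc : IsLocalization (S.map i) B[X] := by
    rw [isLocalization_iff]
    refine ⟨?_, ?_, ?_⟩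
    · rintro ⟨_, s, hs, rfl⟩
      change IsUnit (C (algebraMap D B s))
      exact (IsLocalization.map_units B ⟨s, hs⟩).map C
    · intro f
      obtain ⟨b, hb, hbf⟩ := IsLocalization.integerNormalization_spec S f
      refine ⟨(⟨b • f, ?_⟩, ⟨i b, b, hb, rfl⟩), ?_⟩
      · rw [← hbf]
        change coeff _ 0 ∈ (algebraMap D (Localization S)).range
        rw [coeff_map]
        exact ⟨_, rfl⟩
      · change f * C (algebraMap D B b) = b • f
        rw [mul_comm, ← Polynomial.smul_eq_C_mul, algebraMap_smul]
    · intro x y hxy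
      exact ⟨1, by rw [Subtype.ext hxy]⟩
  refine aux_transfer (T := B[X]) (S.map i) aux_poly P ?_ h1
  rw [Set.disjoint_left]
  rintro _ ⟨s, hs, rfl⟩ hsP
  rw [aux_height_one_iff] at h1
  let ev : R →+* B := (Polynomial.constantCoeff : B[X] →+* B).comp R.subtype
  have hev : ∀ r : R, ev r = (r : B[X]).coeff 0 := fun r => rfl
  have hker : (RingHom.ker ev).IsPrime := RingHom.ker_isPrime ev
  have hle : RingHom.ker ev ≤ P := by
    intro r hr
    rw [RingHom.mem_ker, hev] at hr
    obtain ⟨t, ht⟩ := (IsLocalization.map_units B (⟨s, hs⟩ : S)).exists_right_inv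
    have ht' : algebraMap D B s * t = 1 := ht
    let r' : R := ⟨C t * (r : B[X]), by
      change coeff _ 0 ∈ (algebraMap D (Localization S)).range
      rw [coeff_C_mul, hr, mul_zero]
      exact Subring.zero_mem _⟩
    have : r = i s * r' := by
      apply Subtype.ext
      change (r : B[X]) = C (algebraMap D B s) * (C t * (r : B[X]))
      rw [← mul_assoc, ← C_mul, ht', C_1, one_mul]
    rw [this]
    exact P.mul_mem_right _ hsP
  have hsk : i s ∉ RingHom.ker ev := by
    rw [RingHom.mem_ker, hev, hi, coeff_C_zero]
    intro h
    exact hS s hs (hinj (by rw [h, map_zero]))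
  have hlt : RingHom.ker ev < P := lt_of_le_of_ne hle (fun h => hsk (h ▸ hsP))
  have hbot := h1.2 _ hker hlt
  let xx : R := ⟨X, by
    change coeff _ 0 ∈ (algebraMap D (Localization S)).range
    rw [coeff_X_zero]
    exact Subring.zero_mem _⟩
  have hx : xx ∈ RingHom.ker ev := by
    rw [RingHom.mem_ker, hev]
    exact coeff_X_zero
  rw [hbot, Ideal.mem_bot] at hx
  exact X_ne_zero (congrArg Subtype.val hx)
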